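/- (Correctness of the running example program) If isBST t holds and k ∈ Dom t, then isBST (setData t k d) holds, Dom (setData t k d) = Dom t, and Map (setData t k d) = Map t † {k ↦ d} (as functions ℤ → Option ℤ). -/

import Mathlib

namespace ScopeLogicBST

/-- Binary trees whose nodes carry an integer key and integer data. -/
inductive T : Type where
  | leaf : T
  | node : T → T → ℤ → ℤ → T

/-- The key set of a tree. -/
def Dom : T → Finset ℤ
  | .leaf => ∅
  | .node l r K _ => {K} ∪ Dom l ∪ Dom r

/-- The finite map defined only at `K`, with value `D`. -/
def single (K D : ℤ) : ℤ → Option ℤ := fun k => if k = K then some D else none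

/-- Right-biased override of finite maps. -/
def ovr (M M' : ℤ → Option ℤ) : ℤ → Option ℤ := fun k =>
  match M' k with
  | some v => some v
  | none => M k

infixl:65 " † " => ovr

/-- The finite map retrieved from a tree. -/
def Map : T → ℤ → Option ℤ
  | .leaf => fun _ => none
  | .node l r K D => (single K D † Map l) † Map r

/-- Binary-search-tree property. -/
def isBST : T → Prop
  | .leaf => True
  | .node l r K _ =>
      isBST l ∧ isBST r ∧ (∀ k ∈ Dom l, k < K) ∧ (∀ k ∈ Dom r, K < k)

end ScopeLogicBST

namespace ScopeLogicBST

/-- Search-and-update, mirroring the running example program. -/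
def setData : T → ℤ → ℤ → T
  | .leaf, _, _ => .leaf
  | .node l r K D, k, d =>
      if k < K then .node (setData l k d) r K D
      else if K < k then .node l (setData r k d) K D
      else .node l r K d

end ScopeLogicBST

open ScopeLogicBST

namespace ScopeLogicBST

theorem ovr_single_self (M : ℤ → Option ℤ) (k d : ℤ) : (M † single k d) k = some d := by
  simp [ovr, single]

theorem ovr_single_of_ne (M : ℤ → Option ℤ) {k x : ℤ} (d : ℤ) (h : x ≠ k) :
    (M † single k d) x = M x := by
  simp [ovr, single, h]

theorem Map_eq_none_of_notMem_Dom {t : T} {x : ℤ} (h : x ∉ Dom t) : Map t x = none := by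
  induction t with
  | leaf => rfl
  | node l r K D ihl ihr =>
    simp only [Dom, Finset.mem_union, Finset.mem_singleton, not_or] at h
    simp [Map, ovr, single, h.1.1, ihl h.1.2, ihr h.2]

end ScopeLogicBST

theorem setData_correct (t : T) (k d : ℤ)
    (hbst : isBST t) (hk : k ∈ Dom t) :
    isBST (setData t k d) ∧ Dom (setData t k d) = Dom t ∧
      Map (setData t k d) = Map t † single k d := by
  induction t with
  | leaf => simp [Dom] at hk
  | node l r K D ihl ihr =>
    obtain ⟨hl, hr, hlK, hKr⟩ := hbst
    simp only [Dom, Finset.mem_union, Finset.mem_singleton] at hk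
    rcases lt_trichotomy k K with h | rfl | h
    · have hkr : k ∉ Dom r := fun hm => (hKr k hm).not_gt h
      obtain ⟨hb, hD, hM⟩ := ihl hl ((hk.resolve_right hkr).resolve_left h.ne)
      simp only [setData, h, if_true]
      refine ⟨⟨hb, hr, by rwa [hD], hKr⟩, by simp only [Dom, hD], funext fun x => ?_⟩
      by_cases hx : x = k
      · subst hx
        rw [ovr_single_self]
        simp only [Map, hM]
        simp [ovr, single, Map_eq_none_of_notMem_Dom hkr]
      · rw [ovr_single_of_ne _ d hx]
        simp only [Map, hM]
        simp [ovr, single, hx]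
    · have hkl : k ∉ Dom l := fun hm => (hlK k hm).false
      have hkr : k ∉ Dom r := fun hm => (hKr k hm).false
      simp only [setData, lt_irrefl, if_false]
      refine ⟨⟨hl, hr, hlK, hKr⟩, rfl, funext fun x => ?_⟩
      by_cases hx : x = k
      · subst hx
        rw [ovr_single_self]
        simp [Map, ovr, single, Map_eq_none_of_notMem_Dom hkl, Map_eq_none_of_notMem_Dom hkr]
      · rw [ovr_single_of_ne _ d hx]
        simp [Map, ovr, single, hx]
    · have hkl : k ∉ Dom l := fun hm => (hlK k hm).not_gt h
      obtain ⟨hb, hD, hM⟩ := ihr hr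
        (hk.resolve_left fun hm => hm.elim (fun e => h.ne' e) hkl)
      simp only [setData, h, h.not_gt, if_true, if_false]
      refine ⟨⟨hl, hb, hlK, by rwa [hD]⟩, by simp only [Dom, hD], funext fun x => ?_⟩
      by_cases hx : x = k
      · subst hx
        rw [ovr_single_self]
        simp only [Map, hM]
        simp [ovr, single]
      · rw [ovr_single_of_ne _ d hx]
        simp only [Map, hM]
        simp [ovr, single, hx]
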